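/- Consider the ordinary differential equation ẋ(t) = f(x(t)) with f : ℝⁿ → ℝⁿ, f(0) = 0, where f has continuous partial derivatives of all orders up to n+2. Suppose solutions exist, are unique, and there are constants μ, δ, r > 0 such that every solution x(·) with ‖x(0)‖₂ ≤ r satisfies ‖x(t)‖₂ ≤ μ‖x(0)‖₂ e^{−δt} for all t ≥ 0 (local exponential stability). Then there exists a polynomial v : ℝⁿ → ℝ and constants α, β, γ > 0 such that α‖x‖₂² ≤ v(x) ≤ β‖x‖₂² and ∇v(x)ᵀ f(x) ≤ −γ‖x‖₂² for all x with ‖x‖₂ ≤ r. -/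

import Mathlib

/-- The squared Euclidean norm `xᵀx = ∑ₖ x_k²`. -/
def sqnorm (n : ℕ) (x : Fin n → ℝ) : ℝ := ∑ k, x k ^ 2

/-- The Euclidean norm `‖x‖₂ = √(xᵀx)`. -/
noncomputable def enorm2 (n : ℕ) (x : Fin n → ℝ) : ℝ := Real.sqrt (sqnorm n x)

/-- The partial derivative `∂f/∂x_i`, as the derivative of the one-variable slice. -/
noncomputable def pd (n : ℕ) (i : Fin n) (f : (Fin n → ℝ) → ℝ) : (Fin n → ℝ) → ℝ :=
  fun x => deriv (fun t : ℝ => f (Function.update x i t)) (x i)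

section Approximation

open MeasureTheory

/-- A kernel integrated against a continuous compactly supported function. -/
theorem integrable_smul_comp_sub {n : ℕ} {F : Type*} [NormedAddCommGroup F] [NormedSpace ℝ F]
    {K : (Fin n → ℝ) → ℝ} {g : (Fin n → ℝ) → F} (hK : Continuous K) (hg : Continuous g)
    (hgs : HasCompactSupport g) (x : Fin n → ℝ) : Integrable fun t => K t • g (x - t) := by
  apply Continuous.integrable_of_hasCompactSupport (by fun_prop)
  exact (hgs.comp_homeomorph (Homeomorph.subLeft x)).smul_left

theorem hasFDerivAt_integral_smul_comp_sub {n : ℕ} {F : Type*} [NormedAddCommGroup F]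
    [NormedSpace ℝ F] [CompleteSpace F] {K : (Fin n → ℝ) → ℝ} {g : (Fin n → ℝ) → F}
    (hK : Continuous K) (hg : ContDiff ℝ 1 g) (hgs : HasCompactSupport g) (x : Fin n → ℝ) :
    HasFDerivAt (fun x => ∫ t, K t • g (x - t)) (∫ t, K t • fderiv ℝ g (x - t)) x := by
  have h := hgs.hasFDerivAt_convolution_right (ContinuousLinearMap.lsmul ℝ ℝ)
    (hK.locallyIntegrable (μ := volume)) hg x
  exact h

theorem exists_mvPolynomial_integral_eval_sub_mul {n : ℕ} (p : MvPolynomial (Fin n) ℝ)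
    {g : (Fin n → ℝ) → ℝ} (hg : Continuous g) (hgs : HasCompactSupport g) :
    ∃ q : MvPolynomial (Fin n) ℝ, ∀ x, ∫ t, MvPolynomial.eval (x - t) p * g t =
      MvPolynomial.eval x q := by
  have hint : ∀ (p : MvPolynomial (Fin n) ℝ) {g : (Fin n → ℝ) → ℝ}, Continuous g →
      HasCompactSupport g → ∀ x, Integrable fun t => MvPolynomial.eval (x - t) p * g t := by
    intro p g hg hgs x
    exact Continuous.integrable_of_hasCompactSupport
      ((p.continuous_eval.comp (by fun_prop)).mul hg) hgs.mul_left
  induction p using MvPolynomial.induction_on generalizing g with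
  | C a => exact ⟨MvPolynomial.C (∫ t, a * g t), fun x => by simp⟩
  | add p q hp hq =>
    obtain ⟨P, hP⟩ := hp hg hgs
    obtain ⟨Q, hQ⟩ := hq hg hgs
    refine ⟨P + Q, fun x => ?_⟩
    simp only [map_add, add_mul]
    rw [integral_add (hint p hg hgs x) (hint q hg hgs x), hP, hQ]
  | mul_X p i hp =>
    have hg' : Continuous fun t : Fin n → ℝ => t i * g t := by fun_prop
    have hgs' : HasCompactSupport fun t : Fin n → ℝ => t i * g t := hgs.mul_left
    obtain ⟨P, hP⟩ := hp hg hgs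
    obtain ⟨Q, hQ⟩ := hp hg' hgs'
    refine ⟨MvPolynomial.X i * P - Q, fun x => ?_⟩
    simp only [map_sub, map_mul, MvPolynomial.eval_X, ← hP, ← hQ]
    rw [← integral_const_mul, ← integral_sub ((hint p hg hgs x).const_mul _) (hint p hg' hgs' x)]
    congr 1
    ext t
    simp only [Pi.sub_apply]
    ring

/-- The Weierstrass approximation theorem in several variables. -/
theorem exists_mvPolynomial_near {n : ℕ} {s : Set (Fin n → ℝ)} (hs : IsCompact s)
    {f : (Fin n → ℝ) → ℝ} (hf : Continuous f) {ε : ℝ} (hε : 0 < ε) :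
    ∃ p : MvPolynomial (Fin n) ℝ, ∀ x ∈ s, |MvPolynomial.eval x p - f x| < ε := by
  have : CompactSpace s := isCompact_iff_compactSpace.mp hs
  let coord : Fin n → C(s, ℝ) := fun i => ⟨fun x => x.1 i, (continuous_apply i).comp continuous_subtype_val⟩
  have hsep : (MvPolynomial.aeval (R := ℝ) coord).range.SeparatesPoints := by
    intro x y hxy
    obtain ⟨i, hi⟩ := Function.ne_iff.mp (fun h => hxy (Subtype.ext h))
    exact ⟨coord i, ⟨coord i, ⟨MvPolynomial.X i, by simp⟩, rfl⟩, hi⟩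
  obtain ⟨⟨g, p, rfl⟩, hp⟩ := ContinuousMap.exists_mem_subalgebra_near_continuous_of_separatesPoints
    _ hsep (fun x : s => f x) (by fun_prop) ε hε
  refine ⟨p, fun x hx => ?_⟩
  have h := hp ⟨x, hx⟩
  have key : ∀ q : MvPolynomial (Fin n) ℝ,
      (MvPolynomial.aeval coord q) ⟨x, hx⟩ = MvPolynomial.eval x q := by
    intro q
    induction q using MvPolynomial.induction_on with
    | C a => simp
    | add p q hp hq => simp [hp, hq]
    | mul_X p i hp => simp [hp, coord]
  simpa [key] using h

/-- Convolution with a suitable polynomial kernel is close to the identity. -/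
theorem exists_mvPolynomial_integral_smul_near {n : ℕ} {F : Type*} [NormedAddCommGroup F]
    [NormedSpace ℝ F] [CompleteSpace F] {H : (Fin n → ℝ) → F} (hHc : Continuous H)
    (hHs : HasCompactSupport H) (R : ℝ) {ε : ℝ} (hε : 0 < ε) :
    ∃ p : MvPolynomial (Fin n) ℝ, ∀ x, ‖x‖ ≤ R →
      ‖(∫ t, MvPolynomial.eval t p • H (x - t)) - H x‖ ≤ ε := by
  obtain ⟨η, hη, hηH⟩ := Metric.uniformContinuous_iff.mp
    (hHs.uniformContinuous_of_continuous hHc) (ε / 2) (by positivity)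
  let φ : ContDiffBump (0 : Fin n → ℝ) := ⟨η / 2, η, by positivity, by linarith⟩
  have hφ : ∀ x, dist (∫ t, φ.normed volume t • H (x - t)) (H x) ≤ ε / 2 := fun x =>
    ContDiffBump.dist_normed_convolution_le (φ := φ) (μ := volume) (x₀ := x)
      hHc.aestronglyMeasurable fun y hy => (hηH hy).le
  have hφc : Continuous (φ.normed volume) := φ.continuous_normed
  have hHi : Integrable fun t => ‖H t‖ := (hHc.integrable_of_hasCompactSupport hHs).norm
  set I := ∫ t, ‖H t‖ with hI
  have hI0 : 0 ≤ I := integral_nonneg fun _ => norm_nonneg _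
  obtain ⟨ρ, hρ⟩ := hHs.isBounded.exists_norm_le
  obtain ⟨p, hp⟩ := exists_mvPolynomial_near (isCompact_closedBall (0 : Fin n → ℝ) (R + ρ))
    hφc (ε := ε / (2 * (I + 1))) (by positivity)
  have hpc := p.continuous_eval
  refine ⟨p, fun x hx => ?_⟩
  have hHx : Integrable fun t => ‖H (x - t)‖ := by
    simpa using hHi.comp_sub_left x
  have hdiff : ‖(∫ t, MvPolynomial.eval t p • H (x - t)) - ∫ t, φ.normed volume t • H (x - t)‖
      ≤ ε / 2 := by
    rw [← integral_sub (integrable_smul_comp_sub hpc hHc hHs x)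
      (integrable_smul_comp_sub hφc hHc hHs x)]
    calc _ ≤ ∫ t, ε / (2 * (I + 1)) * ‖H (x - t)‖ := by
          refine norm_integral_le_of_norm_le (hHx.const_mul _)
            (Filter.Eventually.of_forall fun t => ?_)
          rw [← sub_smul, norm_smul]
          by_cases ht : H (x - t) = 0
          · simp [ht]
          · have h1 := hρ _ (subset_tsupport _ ht)
            have h2 : t ∈ Metric.closedBall (0 : Fin n → ℝ) (R + ρ) := by
              rw [mem_closedBall_zero_iff]
              calc ‖t‖ = ‖x - (x - t)‖ := by simp
                _ ≤ _ := (norm_sub_le _ _).trans (add_le_add hx h1)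
            exact mul_le_mul_of_nonneg_right (hp t h2).le (norm_nonneg _)
      _ = ε / (2 * (I + 1)) * I := by
          rw [integral_const_mul, integral_sub_left_eq_self (fun t => ‖H t‖) volume x]
      _ ≤ ε / 2 := by
          rw [div_mul_eq_mul_div, div_le_div_iff₀ (by positivity) (by positivity)]
          nlinarith
  have := hφ x
  rw [dist_eq_norm] at this
  calc _ ≤ _ := norm_sub_le_norm_sub_add_norm_sub _ (∫ t, φ.normed volume t • H (x - t)) _
    _ ≤ ε := by linarith

/-- Polynomials approximate the second derivative of a compactly supported `C²` function. -/
theorem exists_mvPolynomial_fderiv_fderiv_near {n : ℕ} {g : (Fin n → ℝ) → ℝ}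
    (hg : ContDiff ℝ 2 g) (hgs : HasCompactSupport g) (R : ℝ) {ε : ℝ} (hε : 0 < ε) :
    ∃ q : MvPolynomial (Fin n) ℝ, ∀ x, ‖x‖ ≤ R →
      ‖fderiv ℝ (fderiv ℝ fun y => MvPolynomial.eval y q) x - fderiv ℝ (fderiv ℝ g) x‖ ≤ ε := by
  have hg1 : ContDiff ℝ 1 (fderiv ℝ g) := hg.fderiv_right (by norm_num)
  have hgs1 : HasCompactSupport (fderiv ℝ g) := hgs.fderiv ℝ
  obtain ⟨p, hp⟩ := exists_mvPolynomial_integral_smul_near (hg1.continuous_fderiv one_ne_zero)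
    (hgs1.fderiv ℝ) R hε
  obtain ⟨q, hq⟩ := exists_mvPolynomial_integral_eval_sub_mul p hg.continuous hgs
  have hpc := p.continuous_eval
  have e0 : (fun y => MvPolynomial.eval y q) = fun x => ∫ t, MvPolynomial.eval t p • g (x - t) := by
    ext x
    rw [← hq, ← integral_sub_left_eq_self _ _ x]
    simp
  have e1 : fderiv ℝ (fun y => MvPolynomial.eval y q) =
      fun x => ∫ t, MvPolynomial.eval t p • fderiv ℝ g (x - t) := by
    ext1 x
    rw [e0]
    exact (hasFDerivAt_integral_smul_comp_sub hpc (hg.of_le (by norm_num)) hgs x).fderiv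
  refine ⟨q, fun x hx => ?_⟩
  rw [e1, (hasFDerivAt_integral_smul_comp_sub hpc hg1 hgs1 x).fderiv]
  exact hp x hx

theorem MvPolynomial.contDiff_eval {n : ℕ} (p : MvPolynomial (Fin n) ℝ) {k : WithTop ℕ∞} :
    ContDiff ℝ k fun x => MvPolynomial.eval x p :=
  contDiff_iff_contDiffAt.mpr fun x => (AnalyticOnNhd.eval_mvPolynomial p x trivial).contDiffAt

/-- Near the origin of a `C²` function with vanishing first-order jet, polynomials approximate
with errors of the expected orders. -/
theorem exists_mvPolynomial_near_of_fderiv_eq_zero {n : ℕ} {V : (Fin n → ℝ) → ℝ}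
    (hV : ContDiff ℝ 2 V) (hV0 : V 0 = 0) (hV1 : fderiv ℝ V 0 = 0) {R : ℝ} (hR : 0 < R)
    {ε : ℝ} (hε : 0 < ε) :
    ∃ p : MvPolynomial (Fin n) ℝ, ∀ x, ‖x‖ ≤ R →
      |MvPolynomial.eval x p - V x| ≤ ε * ‖x‖ ^ 2 ∧
      ‖fderiv ℝ (fun y => MvPolynomial.eval y p) x - fderiv ℝ V x‖ ≤ ε * ‖x‖ := by
  let χ : ContDiffBump (0 : Fin n → ℝ) := ⟨2 * R, 3 * R, by positivity, by linarith⟩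
  have hg : ContDiff ℝ 2 fun x => χ x * V x := χ.contDiff.mul hV
  obtain ⟨q, hq⟩ := exists_mvPolynomial_fderiv_fderiv_near hg χ.hasCompactSupport.mul_right R hε
  set Q := fun y => MvPolynomial.eval y q with hQ
  have hQc : ContDiff ℝ 2 Q := q.contDiff_eval
  let p := q - (MvPolynomial.C (Q 0) + ∑ i, MvPolynomial.C (fderiv ℝ Q 0 (Pi.single i 1)) *
    MvPolynomial.X i)
  have hp : (fun y => MvPolynomial.eval y p) = fun y => Q y - (Q 0 + fderiv ℝ Q 0 y) := by
    ext y
    have : fderiv ℝ Q 0 y = ∑ i, fderiv ℝ Q 0 (Pi.single i 1) * y i := by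
      conv_lhs => rw [← Finset.univ_sum_single y, map_sum]
      refine Finset.sum_congr rfl fun i _ => ?_
      rw [mul_comm, ← smul_eq_mul, ← map_smul, ← Pi.single_smul]
      simp
    rw [this]
    simp [p, Q]
  have hP' : ∀ x, HasFDerivAt (fun y => MvPolynomial.eval y p) (fderiv ℝ Q x - fderiv ℝ Q 0) x := by
    intro x
    rw [hp]
    exact (hQc.differentiable (by norm_num) x).hasFDerivAt.sub
      ((fderiv ℝ Q 0).hasFDerivAt.const_add _)
  have hP1 : fderiv ℝ (fun y => MvPolynomial.eval y p) = fun x => fderiv ℝ Q x - fderiv ℝ Q 0 :=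
    funext fun x => (hP' x).fderiv
  have hev : ∀ x, ‖x‖ ≤ R → (fun x => χ x * V x) =ᶠ[nhds x] V := by
    intro x hx
    have : Metric.ball (0 : Fin n → ℝ) (2 * R) ∈ nhds x :=
      Metric.isOpen_ball.mem_nhds (by rw [mem_ball_zero_iff]; linarith)
    filter_upwards [this] with y hy
    rw [χ.one_of_mem_closedBall (Metric.ball_subset_closedBall hy), one_mul]
  have hW1 : ∀ x, ‖x‖ ≤ R →
      ‖fderiv ℝ (fun y => MvPolynomial.eval y p) x - fderiv ℝ V x‖ ≤ ε * ‖x‖ := by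
    intro x hx
    have := (convex_closedBall (0 : Fin n → ℝ) ‖x‖).norm_image_sub_le_of_norm_hasFDerivWithin_le
      (f := fun x => fderiv ℝ (fun y => MvPolynomial.eval y p) x - fderiv ℝ V x)
      (f' := fun x => fderiv ℝ (fderiv ℝ Q) x - fderiv ℝ (fderiv ℝ V) x) (C := ε)
      (x := 0) (y := x) (fun y _ => ?_) (fun y hy => ?_) (by simp) (by simp)
    · simpa [hV1, hP1] using this
    · rw [hP1]
      apply HasFDerivAt.hasFDerivWithinAt
      have h1 : Differentiable ℝ (fderiv ℝ Q) :=
        (hQc.fderiv_right (m := 1) (by norm_num)).differentiable (by norm_num)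
      have h2 : Differentiable ℝ (fderiv ℝ V) :=
        (hV.fderiv_right (m := 1) (by norm_num)).differentiable (by norm_num)
      exact ((h1 y).hasFDerivAt.sub_const _).sub (h2 y).hasFDerivAt
    · have hy' : ‖y‖ ≤ R := (mem_closedBall_zero_iff.mp hy).trans hx
      rw [← (hev y hy').fderiv.fderiv_eq]
      exact hq y hy'
  refine ⟨p, fun x hx => ⟨?_, hW1 x hx⟩⟩
  have := (convex_closedBall (0 : Fin n → ℝ) ‖x‖).norm_image_sub_le_of_norm_hasFDerivWithin_le
    (f := fun x => MvPolynomial.eval x p - V x)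
    (f' := fun x => fderiv ℝ (fun y => MvPolynomial.eval y p) x - fderiv ℝ V x) (C := ε * ‖x‖)
    (x := 0) (y := x) (fun y _ => ?_) (fun y hy => ?_) (by simp) (by simp)
  · have h0 : MvPolynomial.eval 0 p = 0 := by simpa using congrFun hp 0
    simpa only [hV0, h0, sub_zero, Real.norm_eq_abs, pow_two, mul_assoc] using this
  · exact (((hP' y).differentiableAt.hasFDerivAt).sub
      (hV.differentiable (by norm_num) y).hasFDerivAt).hasFDerivWithinAt
  · have hy' := mem_closedBall_zero_iff.mp hy
    exact (hW1 y (hy'.trans hx)).trans (by gcongr)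

end Approximation

section Euler

/-- A discrete Grönwall inequality. -/
theorem le_pow_mul_of_succ_le {a : ℕ → ℝ} {q c : ℝ} (hq : 1 ≤ q) (hc : 0 ≤ c) {N : ℕ}
    (h0 : a 0 ≤ 0) (hs : ∀ j < N, a (j + 1) ≤ q * a j + c) :
    ∀ j ≤ N, a j ≤ q ^ j * (j * c) := by
  intro j
  induction j with
  | zero => simpa using h0
  | succ j ih =>
    intro hj
    have h1 := ih (by omega)
    have h2 : 1 ≤ q ^ (j + 1) := one_le_pow₀ hq
    calc a (j + 1) ≤ q * a j + c := hs j (by omega)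
      _ ≤ q * (q ^ j * (j * c)) + q ^ (j + 1) * c := by
        gcongr
        exact le_mul_of_one_le_left hc h2
      _ = q ^ (j + 1) * ((j + 1 : ℕ) * c) := by push_cast; ring

variable {E : Type*} [NormedAddCommGroup E] [NormedSpace ℝ E]

/-- One step of length `h` of the explicit Euler scheme for `ẋ = f x`. -/
def eulerStep (f : E → E) (h : ℝ) (x : E) : E := x + h • f x

theorem eulerStep_iterate_succ (f : E → E) (h : ℝ) (x : E) (j : ℕ) :
    (eulerStep f h)^[j + 1] x = (eulerStep f h)^[j] x + h • f ((eulerStep f h)^[j] x) := by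
  rw [Function.iterate_succ_apply', eulerStep]

theorem norm_eulerStep_iterate_le {f : E → E} {L h : ℝ} (hL : ∀ x, ‖f x‖ ≤ L * ‖x‖)
    (hL0 : 0 ≤ L) (hh : 0 ≤ h) (x : E) (j : ℕ) :
    ‖(eulerStep f h)^[j] x‖ ≤ (1 + h * L) ^ j * ‖x‖ := by
  induction j with
  | zero => simp
  | succ j ih =>
    rw [eulerStep_iterate_succ]
    calc _ ≤ ‖(eulerStep f h)^[j] x‖ + h * (L * ‖(eulerStep f h)^[j] x‖) := by
          refine (norm_add_le _ _).trans ?_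
          rw [norm_smul, Real.norm_of_nonneg hh]
          gcongr
          exact hL _
      _ = (1 + h * L) * ‖(eulerStep f h)^[j] x‖ := by ring
      _ ≤ (1 + h * L) * ((1 + h * L) ^ j * ‖x‖) := by gcongr
      _ = _ := by ring

theorem contDiff_eulerStep_iterate {f : E → E} {k : WithTop ℕ∞} (hf : ContDiff ℝ k f) (h : ℝ)
    (j : ℕ) : ContDiff ℝ k (eulerStep f h)^[j] := by
  induction j with
  | zero => exact contDiff_id
  | succ j ih =>
    rw [Function.iterate_succ']
    exact (contDiff_id.add (hf.const_smul h)).comp ih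

theorem fderiv_eulerStep_iterate_succ {f : E → E} (hf : ContDiff ℝ 1 f) (h : ℝ) (x v : E) (j : ℕ) :
    fderiv ℝ (eulerStep f h)^[j + 1] x v = fderiv ℝ (eulerStep f h)^[j] x v +
      h • fderiv ℝ f ((eulerStep f h)^[j] x) (fderiv ℝ (eulerStep f h)^[j] x v) := by
  have h1 : HasFDerivAt (eulerStep f h)^[j] (fderiv ℝ (eulerStep f h)^[j] x) x :=
    ((contDiff_eulerStep_iterate hf h j).differentiable one_ne_zero x).hasFDerivAt
  have h2 : HasFDerivAt f (fderiv ℝ f ((eulerStep f h)^[j] x)) ((eulerStep f h)^[j] x) :=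
    (hf.differentiable one_ne_zero _).hasFDerivAt
  have h3 : (eulerStep f h)^[j + 1] = fun x => (eulerStep f h)^[j] x +
      h • f ((eulerStep f h)^[j] x) := funext fun x => eulerStep_iterate_succ f h x j
  have h4 : HasFDerivAt (eulerStep f h)^[j + 1] (fderiv ℝ (eulerStep f h)^[j] x +
      h • (fderiv ℝ f ((eulerStep f h)^[j] x)).comp (fderiv ℝ (eulerStep f h)^[j] x)) x := by
    rw [h3]
    exact h1.fun_add ((h2.comp x h1).const_smul h)
  rw [h4.fderiv]
  simp

/-- The Euler scheme almost intertwines the vector field with itself. -/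
theorem norm_fderiv_eulerStep_iterate_sub_le {f : E → E} (hf : ContDiff ℝ 1 f) {L M h W : ℝ}
    (hL0 : 0 ≤ L) (hM : 0 ≤ M) (hL : ∀ x, ‖fderiv ℝ f x‖ ≤ L)
    (hT : ∀ x u, ‖f (x + u) - f x - fderiv ℝ f x u‖ ≤ M * ‖u‖ ^ 2) (hh : 0 ≤ h) (x : E) {N : ℕ}
    (hW : ∀ j < N, ‖f ((eulerStep f h)^[j] x)‖ ≤ W) :
    ∀ j ≤ N, ‖fderiv ℝ (eulerStep f h)^[j] x (f x) - f ((eulerStep f h)^[j] x)‖ ≤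
      (1 + h * L) ^ j * (j * (M * (h * W) ^ 2)) := by
  refine le_pow_mul_of_succ_le (by nlinarith [mul_nonneg hh hL0]) (by positivity) (by simp) ?_
  intro j hj
  rw [fderiv_eulerStep_iterate_succ hf, eulerStep_iterate_succ]
  set φ := (eulerStep f h)^[j] x
  set ψ := fderiv ℝ (eulerStep f h)^[j] x (f x)
  have e : ψ + h • fderiv ℝ f φ ψ - f (φ + h • f φ) =
      (ψ - f φ) + h • fderiv ℝ f φ (ψ - f φ) -
        (f (φ + h • f φ) - f φ - fderiv ℝ f φ (h • f φ)) := by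
    simp only [map_sub, map_smul, smul_sub]
    abel
  rw [e]
  have h1 : ‖fderiv ℝ f φ (ψ - f φ)‖ ≤ L * ‖ψ - f φ‖ :=
    (fderiv ℝ f φ).le_of_opNorm_le (hL φ) _
  have h2 : ‖f (φ + h • f φ) - f φ - fderiv ℝ f φ (h • f φ)‖ ≤ M * (h * W) ^ 2 := by
    refine (hT φ (h • f φ)).trans ?_
    rw [norm_smul, Real.norm_of_nonneg hh]
    gcongr
    exact hW j hj
  calc _ ≤ ‖ψ - f φ‖ + h * (L * ‖ψ - f φ‖) + M * (h * W) ^ 2 := by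
        refine (norm_sub_le _ _).trans (add_le_add ((norm_add_le _ _).trans ?_) h2)
        rw [norm_smul, Real.norm_of_nonneg hh]
        gcongr
    _ = _ := by ring

/-- Convergence of the Euler scheme. -/
theorem norm_eulerStep_iterate_sub_le {f : E → E} {L h W : ℝ} (hL0 : 0 ≤ L)
    (hL : ∀ x y, ‖f x - f y‖ ≤ L * ‖x - y‖) (hh : 0 ≤ h) {y : ℝ → E}
    (hy : ∀ t ≥ (0 : ℝ), HasDerivAt y (f (y t)) t) (hW : ∀ t ≥ (0 : ℝ), ‖f (y t)‖ ≤ W) (j : ℕ) :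
    ‖(eulerStep f h)^[j] (y 0) - y (j * h)‖ ≤ (1 + h * L) ^ j * (j * (L * W * h ^ 2)) := by
  have hW0 : 0 ≤ W := (norm_nonneg _).trans (hW 0 le_rfl)
  have hstep : ∀ a ≥ (0 : ℝ), ‖y (a + h) - y a - h • f (y a)‖ ≤ L * W * h ^ 2 := by
    intro a ha
    have h1 : ∀ s ∈ Set.Icc a (a + h), ‖y s - y a‖ ≤ W * (s - a) :=
      norm_image_sub_le_of_norm_deriv_le_segment' (f' := fun t => f (y t))
        (fun t ht => (hy t (ha.le.trans ht.1)).hasDerivWithinAt)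
        (fun t ht => hW t (ha.le.trans ht.1))
    have h2 := norm_image_sub_le_of_norm_deriv_le_segment' (f := fun t => y t - (t - a) • f (y a))
      (f' := fun t => f (y t) - (1 : ℝ) • f (y a)) (a := a) (b := a + h) (C := L * W * h)
      (fun t ht => ((hy t (ha.le.trans ht.1)).sub
        (((hasDerivAt_id t).sub_const a).smul_const (f (y a)))).hasDerivWithinAt)
      (fun t ht => by
        rw [one_smul]
        calc _ ≤ L * ‖y t - y a‖ := hL _ _
          _ ≤ L * (W * (t - a)) := by gcongr; exact h1 t ⟨ht.1, ht.2.le⟩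
          _ ≤ L * (W * h) := by gcongr; linarith [ht.2]
          _ = _ := by ring)
      (a + h) ⟨by linarith, le_rfl⟩
    calc _ = ‖y (a + h) - (a + h - a) • f (y a) - (y a - (a - a) • f (y a))‖ := by
          congr 1
          simp only [add_sub_cancel_left, sub_self, zero_smul, sub_zero]
          abel
      _ ≤ _ := h2
      _ = _ := by ring
  refine le_pow_mul_of_succ_le (a := fun j => ‖(eulerStep f h)^[j] (y 0) - y (j * h)‖)
    (by nlinarith [mul_nonneg hh hL0]) (by positivity) (by simp) (fun j _ => ?_) j le_rfl
  have e : (eulerStep f h)^[j + 1] (y 0) - y ((j + 1 : ℕ) * h) =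
      ((eulerStep f h)^[j] (y 0) - y (j * h)) +
      h • (f ((eulerStep f h)^[j] (y 0)) - f (y (j * h))) -
      (y (j * h + h) - y (j * h) - h • f (y (j * h))) := by
    rw [eulerStep_iterate_succ, show ((j + 1 : ℕ) : ℝ) * h = j * h + h by push_cast; ring, smul_sub]
    abel
  rw [e]
  calc _ ≤ ‖(eulerStep f h)^[j] (y 0) - y (j * h)‖ +
        h * (L * ‖(eulerStep f h)^[j] (y 0) - y (j * h)‖) + L * W * h ^ 2 := by
        refine (norm_sub_le _ _).trans (add_le_add ((norm_add_le _ _).trans ?_)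
          (hstep _ (by positivity)))
        rw [norm_smul, Real.norm_of_nonneg hh]
        gcongr
        exact hL _ _
    _ = _ := by ring

/-- A `C²` Lyapunov function for a vector field whose solutions have contracted by time `T`:
the Riemann sum of the quadratic form `B` along the Euler scheme. -/
theorem exists_contDiff_two_lyapunov {B : E →L[ℝ] E →L[ℝ] ℝ} (hsymm : ∀ a b, B a b = B b a)
    (hB : ∀ a, ‖a‖ ^ 2 ≤ B a a) {f : E → E} (hf : ContDiff ℝ 2 f) (hf0 : f 0 = 0) {L M : ℝ}
    (hL0 : 0 ≤ L) (hM : 0 ≤ M) (hL : ∀ x y, ‖f x - f y‖ ≤ L * ‖x - y‖)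
    (hT : ∀ x u, ‖f (x + u) - f x - fderiv ℝ f x u‖ ≤ M * ‖u‖ ^ 2) {S : Set E} {ρ A' T : ℝ}
    (hρ0 : 0 ≤ ρ) (hρ : ∀ x ∈ S, ‖x‖ ≤ ρ) (hA' : 0 ≤ A') (hT0 : 0 < T)
    (hy : ∀ x ∈ S, ∃ y : ℝ → E, y 0 = x ∧ (∀ t ≥ (0 : ℝ), HasDerivAt y (f (y t)) t) ∧
      (∀ t ≥ (0 : ℝ), ‖y t‖ ≤ A' * ‖x‖) ∧ B (y T) (y T) ≤ 1 / 4 * B x x) :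
    ∃ (V : E → ℝ) (a b : ℝ), 0 < a ∧ 0 < b ∧ ContDiff ℝ 2 V ∧ V 0 = 0 ∧ fderiv ℝ V 0 = 0 ∧
      ∀ x, a * ‖x‖ ^ 2 ≤ V x ∧ V x ≤ b * ‖x‖ ^ 2 ∧
        (x ∈ S → fderiv ℝ V x (f x) ≤ -(1 / 2) * ‖x‖ ^ 2) := by
  have hf1 : ContDiff ℝ 1 f := hf.of_le (by norm_num)
  have hLf : ∀ x, ‖f x‖ ≤ L * ‖x‖ := fun x => by simpa [hf0] using hL x 0
  have hLD : ∀ x, ‖fderiv ℝ f x‖ ≤ L := fun x =>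
    (norm_fderiv_le_of_lipschitz ℝ (C := ⟨L, hL0⟩) (LipschitzWith.of_dist_le_mul fun x y => by
      rw [dist_eq_norm, dist_eq_norm]
      exact hL x y))
  set C := ‖B‖
  have hC0 : 0 ≤ C := norm_nonneg B
  have hC : ∀ a b, B a b ≤ C * ‖a‖ * ‖b‖ := fun a b =>
    (le_abs_self _).trans (B.le_opNorm₂ a b)
  set A := Real.exp (L * T)
  have hA0 : 0 < A := Real.exp_pos _
  set K₁ := A * T * M * (L * A) ^ 2 * ρ
  set K₂ := A * T * L * (L * A')
  have hK₁ : 0 ≤ K₁ := by positivity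
  have hK₂ : 0 ≤ K₂ := by positivity
  set K := 2 * C * T * A * K₁ + C * K₂ * (A + A')
  obtain ⟨N, hN⟩ := exists_nat_gt (4 * T * K)
  have hK : 0 ≤ K := by positivity
  have hN0 : (0 : ℝ) < N := lt_of_le_of_lt (by positivity) hN
  set h := T / N
  have hh : 0 < h := by positivity
  have hhN : N * h = T := by simp only [h]; field_simp
  have hhK : h * K ≤ 1 / 4 := by
    simp only [h]
    rw [div_mul_eq_mul_div, div_le_iff₀ hN0]
    linarith
  have hpow : ∀ j ≤ N, (1 + h * L) ^ j ≤ A := by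
    intro j hj
    calc (1 + h * L) ^ j ≤ (1 + h * L) ^ N :=
          pow_le_pow_right₀ (by nlinarith [mul_nonneg hh.le hL0]) hj
      _ ≤ Real.exp (h * L) ^ N := by
          gcongr
          linarith [Real.add_one_le_exp (h * L)]
      _ = A := by
          rw [← Real.exp_nat_mul]
          simp only [A]
          rw [← hhN]
          ring_nf
  have hφ : ∀ x, ∀ j ≤ N, ‖(eulerStep f h)^[j] x‖ ≤ A * ‖x‖ := fun x j hj =>
    (norm_eulerStep_iterate_le hLf hL0 hh.le x j).trans (by gcongr; exact hpow j hj)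
  have hB0 : ∀ a, 0 ≤ B a a := fun a => (sq_nonneg _).trans (hB a)
  let V : E → ℝ := fun x => h * ∑ j ∈ Finset.range N,
    B ((eulerStep f h)^[j] x) ((eulerStep f h)^[j] x)
  have hlow : ∀ x, h * ‖x‖ ^ 2 ≤ V x := by
    intro x
    refine mul_le_mul_of_nonneg_left ((hB x).trans ?_) hh.le
    have hN' : 0 ∈ Finset.range N := by
      rw [Finset.mem_range]; exact_mod_cast hN0
    exact Finset.single_le_sum (f := fun j => B ((eulerStep f h)^[j] x) ((eulerStep f h)^[j] x))
      (fun j _ => hB0 _) hN'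
  have hup : ∀ x, V x ≤ (T * C * A ^ 2 + 1) * ‖x‖ ^ 2 := by
    intro x
    calc V x ≤ h * ∑ j ∈ Finset.range N, C * (A * ‖x‖) * (A * ‖x‖) := by
          refine mul_le_mul_of_nonneg_left (Finset.sum_le_sum fun j hj => ?_) hh.le
          have := hφ x j (Finset.mem_range.mp hj).le
          exact (hC _ _).trans (by gcongr)
      _ = N * h * C * A ^ 2 * ‖x‖ ^ 2 := by
          rw [Finset.sum_const, Finset.card_range, nsmul_eq_mul]; ring
      _ ≤ _ := by rw [hhN]; nlinarith [sq_nonneg ‖x‖]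
  have hV0 : V 0 = 0 := le_antisymm (by simpa using hup 0) (by simpa using hlow 0)
  have hVc : ContDiff ℝ 2 V := by
    refine contDiff_const.mul (ContDiff.sum fun j _ => ?_)
    have := contDiff_eulerStep_iterate hf h j
    exact (B.contDiff.comp this).clm_apply this
  refine ⟨V, h, T * C * A ^ 2 + 1, hh, by positivity, hVc, hV0, ?_, fun x => ⟨hlow x, hup x, ?_⟩⟩
  · apply IsLocalMin.fderiv_eq_zero
    refine Filter.Eventually.of_forall fun x => ?_
    rw [hV0]
    exact (by positivity : 0 ≤ h * ‖x‖ ^ 2).trans (hlow x)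
  · intro hx
    obtain ⟨y, hy0, hyd, hyb, hyT⟩ := hy x hx
    set φ : ℕ → E := fun j => (eulerStep f h)^[j] x
    set ψ : ℕ → E := fun j => fderiv ℝ (eulerStep f h)^[j] x (f x)
    have hDV : fderiv ℝ V x (f x) = h * ∑ j ∈ Finset.range N, 2 * B (φ j) (ψ j) := by
      have h1 : ∀ j, HasFDerivAt (eulerStep f h)^[j] (fderiv ℝ (eulerStep f h)^[j] x) x := fun j =>
        ((contDiff_eulerStep_iterate hf h j).differentiable (by norm_num) x).hasFDerivAt
      have h2 : HasFDerivAt V _ x := (HasFDerivAt.fun_sum fun j (_ : j ∈ Finset.range N) =>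
        (B.hasFDerivAt.comp x (h1 j)).clm_apply (h1 j)).const_mul h
      rw [h2.fderiv]
      simp only [smul_apply, sum_apply, smul_eq_mul]
      congr 1
      refine Finset.sum_congr rfl fun j _ => ?_
      simp only [add_apply, ContinuousLinearMap.comp_apply,
        ContinuousLinearMap.flip_apply, Function.comp_apply]
      rw [hsymm (fderiv ℝ (eulerStep f h)^[j] x (f x))]
      simp only [φ, ψ]
      ring
    have he : ∀ j ≤ N, ‖ψ j - f (φ j)‖ ≤ h * K₁ * ‖x‖ := by
      intro j hj
      refine (norm_fderiv_eulerStep_iterate_sub_le hf1 hL0 hM hLD hT hh.le x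
        (W := L * (A * ‖x‖)) (fun i hi => (hLf _).trans ?_) j hj).trans ?_
      · gcongr
        exact hφ x i hi.le
      · calc _ ≤ A * (N * (M * (h * (L * (A * ‖x‖))) ^ 2)) := by
              gcongr
              exact hpow j hj
          _ = h * (A * (N * h) * M * (L * A) ^ 2 * ‖x‖) * ‖x‖ := by ring
          _ ≤ h * K₁ * ‖x‖ := by
              rw [hhN]
              simp only [K₁]
              gcongr
              exact hρ x hx
    have hd : ‖φ N - y T‖ ≤ h * K₂ * ‖x‖ := by
      have := norm_eulerStep_iterate_sub_le hL0 hL hh.le hyd (W := L * (A' * ‖x‖))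
        (fun t ht => (hLf _).trans (by gcongr; exact hyb t ht)) N
      rw [hy0, hhN] at this
      refine this.trans ?_
      calc _ ≤ A * (N * (L * (L * (A' * ‖x‖)) * h ^ 2)) := by
            gcongr
            exact hpow N le_rfl
        _ = h * (A * (N * h) * L * (L * A')) * ‖x‖ := by ring
        _ = _ := by rw [hhN]
    have hend : B (φ N) (φ N) ≤ 1 / 4 * B x x + h * (C * K₂ * (A + A')) * ‖x‖ ^ 2 := by
      have e : B (φ N) (φ N) = B (y T) (y T) + B (φ N - y T) (φ N + y T) := by
        simp only [map_sub, map_add, sub_apply]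
        rw [hsymm (y T) (φ N)]
        ring
      have h1 : ‖φ N + y T‖ ≤ (A + A') * ‖x‖ := by
        refine (norm_add_le _ _).trans ?_
        rw [add_mul]
        exact add_le_add (hφ x N le_rfl) (hyb T hT0.le)
      have h2 : B (φ N - y T) (φ N + y T) ≤ C * (h * K₂ * ‖x‖) * ((A + A') * ‖x‖) :=
        (hC _ _).trans (by gcongr)
      rw [e]
      linarith
    have hterm : ∀ j ∈ Finset.range N, h * (2 * B (φ j) (ψ j)) ≤
        (B (φ (j + 1)) (φ (j + 1)) - B (φ j) (φ j)) + h * (2 * (C * (A * ‖x‖) * (h * K₁ * ‖x‖))) := by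
      intro j hj
      have hj' := (Finset.mem_range.mp hj).le
      have h1 : B (φ j) (ψ j - f (φ j)) ≤ C * (A * ‖x‖) * (h * K₁ * ‖x‖) := by
        refine (hC _ _).trans ?_
        gcongr
        · exact hφ x j hj'
        · exact he j hj'
      have h2 : φ (j + 1) = φ j + h • f (φ j) := eulerStep_iterate_succ f h x j
      have h3 : B (φ (j + 1)) (φ (j + 1)) - B (φ j) (φ j) =
          h * (2 * B (φ j) (f (φ j))) + h ^ 2 * B (f (φ j)) (f (φ j)) := by
        rw [h2]
        simp only [map_add, map_smul, add_apply,
          smul_apply, smul_eq_mul]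
        rw [hsymm (f (φ j)) (φ j)]
        ring
      have h4 : B (φ j) (ψ j) = B (φ j) (f (φ j)) + B (φ j) (ψ j - f (φ j)) := by
        rw [map_sub]; ring
      have h5 : 0 ≤ h ^ 2 * B (f (φ j)) (f (φ j)) := mul_nonneg (sq_nonneg _) (hB0 _)
      rw [h3, h4]
      nlinarith [mul_le_mul_of_nonneg_left h1 hh.le]
    have hx2 := hB x
    calc fderiv ℝ V x (f x) = ∑ j ∈ Finset.range N, h * (2 * B (φ j) (ψ j)) := by
          rw [hDV, Finset.mul_sum]
      _ ≤ _ := Finset.sum_le_sum hterm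
      _ = (B (φ N) (φ N) - B x x) + h * (2 * C * (N * h) * A * K₁) * ‖x‖ ^ 2 := by
          rw [Finset.sum_add_distrib, Finset.sum_range_sub (fun j => B (φ j) (φ j)),
            Finset.sum_const, Finset.card_range, nsmul_eq_mul]
          simp only [φ, Function.iterate_zero, id]
          ring
      _ ≤ -(3 / 4) * B x x + h * K * ‖x‖ ^ 2 := by
          rw [hhN]
          simp only [K]
          linarith
      _ ≤ _ := by nlinarith [mul_le_mul_of_nonneg_right hhK (sq_nonneg ‖x‖)]

end Euler

section Main

theorem sum_pd_mul_eq_fderiv {n : ℕ} {v : (Fin n → ℝ) → ℝ} {x : Fin n → ℝ}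
    (hv : DifferentiableAt ℝ v x) (w : Fin n → ℝ) :
    ∑ i, pd n i v x * w i = fderiv ℝ v x w := by
  have hpd : ∀ i, pd n i v x = fderiv ℝ v x (Pi.single i 1) := by
    intro i
    have h1 : HasFDerivAt v (fderiv ℝ v x) (Function.update x i (x i)) := by
      rw [Function.update_eq_self]
      exact hv.hasFDerivAt
    exact (h1.comp_hasDerivAt (x i) (hasDerivAt_update x i (x i))).deriv
  conv_rhs => rw [← Finset.univ_sum_single w, map_sum]
  refine Finset.sum_congr rfl fun i _ => ?_
  rw [hpd, mul_comm, ← smul_eq_mul, ← map_smul, ← Pi.single_smul]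
  simp

theorem sqnorm_nonneg (n : ℕ) (x : Fin n → ℝ) : 0 ≤ sqnorm n x :=
  Finset.sum_nonneg fun _ _ => sq_nonneg _

theorem norm_sq_le_sqnorm (n : ℕ) (x : Fin n → ℝ) : ‖x‖ ^ 2 ≤ sqnorm n x := by
  have h : ‖x‖ ≤ √(sqnorm n x) := by
    refine (pi_norm_le_iff_of_nonneg (Real.sqrt_nonneg _)).mpr fun i => ?_
    refine Real.le_sqrt_of_sq_le ?_
    rw [Real.norm_eq_abs, sq_abs]
    exact Finset.single_le_sum (f := fun i => x i ^ 2) (fun i _ => sq_nonneg _) (Finset.mem_univ i)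
  exact (Real.le_sqrt (norm_nonneg x) (sqnorm_nonneg n x)).mp h

theorem sqnorm_le (n : ℕ) (x : Fin n → ℝ) : sqnorm n x ≤ (n + 1) * ‖x‖ ^ 2 := by
  calc sqnorm n x ≤ ∑ _i : Fin n, ‖x‖ ^ 2 := by
        refine Finset.sum_le_sum fun i _ => ?_
        rw [← sq_abs, ← Real.norm_eq_abs]
        gcongr
        exact norm_le_pi_norm x i
    _ ≤ (n + 1) * ‖x‖ ^ 2 := by
        rw [Finset.sum_const, Finset.card_univ, Fintype.card_fin, nsmul_eq_mul]
        gcongr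
        linarith

theorem enorm2_sq (n : ℕ) (x : Fin n → ℝ) : enorm2 n x ^ 2 = sqnorm n x :=
  Real.sq_sqrt (sqnorm_nonneg n x)

theorem norm_le_enorm2 (n : ℕ) (x : Fin n → ℝ) : ‖x‖ ≤ enorm2 n x :=
  Real.le_sqrt_of_sq_le (norm_sq_le_sqnorm n x)

theorem enorm2_le (n : ℕ) (x : Fin n → ℝ) : enorm2 n x ≤ (n + 1) * ‖x‖ := by
  refine Real.sqrt_le_iff.mpr ⟨by positivity, (sqnorm_le n x).trans ?_⟩
  rw [mul_pow]
  gcongr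
  nlinarith [Nat.cast_nonneg (α := ℝ) n]

/-- The Euclidean inner product as a continuous bilinear form on `Fin n → ℝ`. -/
noncomputable def dotCLM (n : ℕ) : (Fin n → ℝ) →L[ℝ] (Fin n → ℝ) →L[ℝ] ℝ :=
  ∑ i, (ContinuousLinearMap.proj (R := ℝ) (φ := fun _ : Fin n => ℝ) i).smulRight
    (ContinuousLinearMap.proj (R := ℝ) (φ := fun _ : Fin n => ℝ) i)

theorem dotCLM_apply (n : ℕ) (a b : Fin n → ℝ) : dotCLM n a b = ∑ i, a i * b i := by
  simp [dotCLM, sum_apply]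

theorem dotCLM_self (n : ℕ) (a : Fin n → ℝ) : dotCLM n a a = sqnorm n a := by
  simp [dotCLM_apply, sqnorm, pow_two]

/-- Quadratic remainder estimate for compactly supported `C²` maps. -/
theorem exists_norm_sub_sub_fderiv_le {E F : Type*} [NormedAddCommGroup E] [NormedSpace ℝ E]
    [NormedAddCommGroup F] [NormedSpace ℝ F] {f : E → F} (hf : ContDiff ℝ 2 f)
    (hfs : HasCompactSupport f) :
    ∃ M, 0 ≤ M ∧ ∀ x u, ‖f (x + u) - f x - fderiv ℝ f x u‖ ≤ M * ‖u‖ ^ 2 := by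
  obtain ⟨M, hM⟩ := (hf.fderiv_right (m := 1) (by norm_num)).lipschitzWith_of_hasCompactSupport
    (hfs.fderiv ℝ) one_ne_zero
  refine ⟨M, M.2, fun x u => ?_⟩
  have := (convex_closedBall x ‖u‖).norm_image_sub_le_of_norm_hasFDerivWithin_le'
    (f := f) (f' := fderiv ℝ f) (φ := fderiv ℝ f x) (C := M * ‖u‖) (x := x) (y := x + u)
    (fun y _ => (hf.differentiable (by norm_num) y).hasFDerivAt.hasFDerivWithinAt)
    (fun y hy => ?_) (by simp) (by simp)
  · rw [add_sub_cancel_left] at this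
    rwa [pow_two, ← mul_assoc]
  · refine (hM.norm_sub_le y x).trans ?_
    gcongr
    exact mem_closedBall_iff_norm.mp hy

end Main

/-- consider `ẋ = f(x)` with `f(0) = 0`, where `f` has continuous
partial derivatives of all orders up to `n + 2`.  Suppose solutions exist, are
unique, and with constants `μ, δ, r > 0` every solution with `‖x(0)‖₂ ≤ r`
satisfies `‖x(t)‖₂ ≤ μ‖x(0)‖₂ e^{−δt}` for all `t ≥ 0` (local exponential
stability).  Then there exist a polynomial `v : ℝⁿ → ℝ` and constants
`α, β, γ > 0` such that `α‖x‖₂² ≤ v(x) ≤ β‖x‖₂²` and `∇v(x)ᵀ f(x) ≤ −γ‖x‖₂²`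
for all `‖x‖₂ ≤ r`. -/
theorem converse_lyapunov_poly (n : ℕ) (f : (Fin n → ℝ) → (Fin n → ℝ))
    (hf : ContDiff ℝ (n + 2 : ℕ) f) (hf0 : f 0 = 0)
    (μ δ r : ℝ) (hμ : 0 < μ) (hδ : 0 < δ) (hr : 0 < r)
    (hex : ∀ x₀ : Fin n → ℝ, enorm2 n x₀ ≤ r →
      ∃ x : ℝ → (Fin n → ℝ), x 0 = x₀ ∧ ∀ t ≥ (0:ℝ), HasDerivAt x (f (x t)) t)
    (huniq : ∀ x y : ℝ → (Fin n → ℝ),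
      (∀ t ≥ (0:ℝ), HasDerivAt x (f (x t)) t) →
      (∀ t ≥ (0:ℝ), HasDerivAt y (f (y t)) t) →
      x 0 = y 0 → ∀ t ≥ (0:ℝ), x t = y t)
    (hstab : ∀ x : ℝ → (Fin n → ℝ),
      (∀ t ≥ (0:ℝ), HasDerivAt x (f (x t)) t) → enorm2 n (x 0) ≤ r →
      ∀ t ≥ (0:ℝ), enorm2 n (x t) ≤ μ * enorm2 n (x 0) * Real.exp (-δ * t)) :
    ∃ (v : MvPolynomial (Fin n) ℝ) (a b c : ℝ), 0 < a ∧ 0 < b ∧ 0 < c ∧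
      ∀ x : Fin n → ℝ, enorm2 n x ≤ r →
        a * sqnorm n x ≤ MvPolynomial.eval x v ∧
        MvPolynomial.eval x v ≤ b * sqnorm n x ∧
        ∑ i, pd n i (fun y => MvPolynomial.eval y v) x * f x i ≤ -c * sqnorm n x := by
  have hf2 : ContDiff ℝ 2 f := hf.of_le (by exact_mod_cast Nat.le_add_left 2 n)
  let χ : ContDiffBump (0 : Fin n → ℝ) :=
    ⟨(μ + 1) * r, 2 * ((μ + 1) * r), by positivity, by linarith [mul_pos (add_pos hμ one_pos) hr]⟩
  set F : (Fin n → ℝ) → (Fin n → ℝ) := fun x => χ x • f x with hF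
  have hFf : ∀ x, ‖x‖ ≤ (μ + 1) * r → F x = f x := by
    intro x hx
    rw [hF]
    beta_reduce
    rw [χ.one_of_mem_closedBall (mem_closedBall_zero_iff.mpr hx), one_smul]
  have hFc : ContDiff ℝ 2 F := χ.contDiff.smul hf2
  have hFs : HasCompactSupport F := χ.hasCompactSupport.smul_right
  have hF0 : F 0 = 0 := by rw [hF]; simp [hf0]
  obtain ⟨L, hL⟩ := hFc.lipschitzWith_of_hasCompactSupport hFs (by norm_num)
  obtain ⟨M, hM0, hM⟩ := exists_norm_sub_sub_fderiv_le hFc hFs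
  have hT : μ * Real.exp (-δ * (2 * μ / δ)) ≤ 1 / 2 := by
    have h1 : -δ * (2 * μ / δ) = -(2 * μ) := by field_simp
    rw [h1, Real.exp_neg, ← div_eq_mul_inv, div_le_iff₀ (Real.exp_pos _)]
    linarith [Real.add_one_le_exp (2 * μ)]
  have hsol : ∀ x ∈ {x | enorm2 n x ≤ r}, ∃ y : ℝ → (Fin n → ℝ), y 0 = x ∧
      (∀ t ≥ (0 : ℝ), HasDerivAt y (F (y t)) t) ∧
      (∀ t ≥ (0 : ℝ), ‖y t‖ ≤ μ * (n + 1) * ‖x‖) ∧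
      dotCLM n (y (2 * μ / δ)) (y (2 * μ / δ)) ≤ 1 / 4 * dotCLM n x x := by
    intro x hx
    obtain ⟨y, hy0, hy⟩ := hex x hx
    have hst := hstab y hy (by rw [hy0]; exact hx)
    rw [hy0] at hst
    have hx0 : 0 ≤ enorm2 n x := Real.sqrt_nonneg _
    have hst' : ∀ t ≥ (0 : ℝ), ‖y t‖ ≤ μ * enorm2 n x := by
      intro t ht
      refine (norm_le_enorm2 n _).trans ((hst t ht).trans ?_)
      refine mul_le_of_le_one_right (by positivity) (Real.exp_le_one_iff.mpr ?_)
      nlinarith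
    refine ⟨y, hy0, fun t ht => ?_, fun t ht => ?_, ?_⟩
    · rw [hFf]
      · exact hy t ht
      · refine (hst' t ht).trans ?_
        have : enorm2 n x ≤ r := hx
        nlinarith
    · rw [mul_assoc]
      exact (hst' t ht).trans (by gcongr; exact enorm2_le n x)
    · rw [dotCLM_self, dotCLM_self, ← enorm2_sq, ← enorm2_sq]
      have h1 := hst (2 * μ / δ) (by positivity)
      have h2 : enorm2 n (y (2 * μ / δ)) ≤ 1 / 2 * enorm2 n x := by
        refine h1.trans ?_
        rw [mul_right_comm]
        gcongr
      calc _ ≤ (1 / 2 * enorm2 n x) ^ 2 := by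
            have h3 : 0 ≤ enorm2 n (y (2 * μ / δ)) := Real.sqrt_nonneg _
            gcongr
        _ = _ := by ring
  obtain ⟨V, a, b, ha, hb, hVc, hV0, hV1, hV⟩ := exists_contDiff_two_lyapunov
    (fun a b => by simp only [dotCLM_apply, mul_comm])
    (fun a => by rw [dotCLM_self]; exact norm_sq_le_sqnorm n a) hFc hF0 L.2 hM0
    (fun x y => hL.norm_sub_le x y) hM hr.le
    (fun x hx => (norm_le_enorm2 n x).trans hx) (by positivity : 0 ≤ μ * (n + 1))
    (by positivity : 0 < 2 * μ / δ) hsol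
  set ε := min (a / 2) (1 / (4 * (L + 1)) : ℝ) with hε
  have hε0 : 0 < ε := by
    have := L.2
    exact lt_min (by positivity) (by positivity)
  have hεa : ε ≤ a / 2 := min_le_left _ _
  have hεL : ε * L ≤ 1 / 4 := by
    have hL1 : (0 : ℝ) < L + 1 := by positivity
    calc ε * L ≤ 1 / (4 * (L + 1)) * (L + 1) := by
          gcongr
          · exact min_le_right _ _
          · linarith
      _ = 1 / 4 := by field_simp
  obtain ⟨v, hv⟩ := exists_mvPolynomial_near_of_fderiv_eq_zero hVc hV0 hV1 hr hε0
  refine ⟨v, a / (2 * (n + 1)), b + ε, 1 / (4 * (n + 1)), by positivity, by positivity,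
    by positivity, fun x hx => ?_⟩
  have hxr : ‖x‖ ≤ r := (norm_le_enorm2 n x).trans hx
  obtain ⟨hv0, hv1⟩ := hv x hxr
  obtain ⟨hVa, hVb, hVd⟩ := hV x
  have hq1 := norm_sq_le_sqnorm n x
  have hq2 : sqnorm n x / (n + 1) ≤ ‖x‖ ^ 2 := by
    rw [div_le_iff₀ (by positivity), mul_comm]
    exact sqnorm_le n x
  rw [abs_le] at hv0
  refine ⟨?_, ?_, ?_⟩
  · calc a / (2 * (n + 1)) * sqnorm n x = a / 2 * (sqnorm n x / (n + 1)) := by field_simp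
      _ ≤ a / 2 * ‖x‖ ^ 2 := by gcongr
      _ ≤ _ := by nlinarith [mul_le_mul_of_nonneg_right hεa (sq_nonneg ‖x‖)]
  · calc MvPolynomial.eval x v ≤ (b + ε) * ‖x‖ ^ 2 := by linarith
      _ ≤ _ := by gcongr
  · have hFx : F x = f x := hFf x (hxr.trans (by nlinarith))
    have hFn : ‖f x‖ ≤ L * ‖x‖ := by
      rw [← hFx]
      simpa [hF0] using hL.norm_sub_le x 0
    rw [sum_pd_mul_eq_fderiv (v.contDiff_eval.differentiable one_ne_zero x)]
    set D := fderiv ℝ (fun y => MvPolynomial.eval y v) x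
    have h1 : (D - fderiv ℝ V x) (f x) ≤ ε * ‖x‖ * (L * ‖x‖) :=
      (le_abs_self _).trans (((D - fderiv ℝ V x).le_opNorm (f x)).trans (by gcongr))
    have h2 := hVd hx
    rw [hFx] at h2
    rw [sub_apply] at h1
    calc D (f x) ≤ -(1 / 4) * ‖x‖ ^ 2 := by
          nlinarith [mul_le_mul_of_nonneg_right hεL (sq_nonneg ‖x‖)]
      _ ≤ -(1 / 4) * (sqnorm n x / (n + 1)) := by linarith
      _ = _ := by field_simp
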